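/- arXiv:2203.02597 — 2 statements merged into one kernel-verified Lean document; each statement's English description precedes it below -/
import Mathlib

section
/- (Properties of t↦mfcr*_t, parts 2 and 3.) In the finite mixture model, under Assumption 1: (ii) mfcr*_t < t for every t∈(0,1]; and (iii) t↦mfcr*_t is continuous on (t*(α_c), 1]. -/
open MeasureTheory ProbabilityTheory Finset
open scoped ENNReal

noncomputable section
namespace FCRPaper

variable {E U P : Type*} [MeasurableSpace E]

/-- Posterior probability `ℓ_q(x,θ)`. -/
def post {Q : ℕ} (f : U → E → ℝ) (piF : P → Fin Q → ℝ) (phiF : P → Fin Q → U)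
    (θ : P) (q : Fin Q) (x : E) : ℝ :=
  piF θ q * f (phiF θ q) x / ∑ l, piF θ l * f (phiF θ l) x

/-- `T(x,θ) = 1 - max_q ℓ_q(x,θ)`. -/
def Tstat {Q : ℕ} (f : U → E → ℝ) (piF : P → Fin Q → ℝ) (phiF : P → Fin Q → U)
    (θ : P) (x : E) : ℝ :=
  1 - ⨆ q, post f piF phiF θ q x

/-- Joint law of `(Z, X)` under parameter `θ` (base measure `μE` on `E`). -/
def jointLaw {Q : ℕ} (μE : Measure E) (f : U → E → ℝ) (piF : P → Fin Q → ℝ)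
    (phiF : P → Fin Q → U) (θ : P) : Measure (Fin Q × E) :=
  ∑ q : Fin Q, ENNReal.ofReal (piF θ q) •
    ((Measure.dirac q).prod (μE.withDensity fun x => ENNReal.ofReal (f (phiF θ q) x)))

/-- Marginal law of `X` under parameter `θ`. -/
def margLaw {Q : ℕ} (μE : Measure E) (f : U → E → ℝ) (piF : P → Fin Q → ℝ)
    (phiF : P → Fin Q → U) (θ : P) : Measure E :=
  ∑ q : Fin Q, ENNReal.ofReal (piF θ q) •
    (μE.withDensity fun x => ENNReal.ofReal (f (phiF θ q) x))

/-- The σ-algebra generated by the sample `X = (X_1, …, X_n)`. -/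
def sigmaX {Ω : Type*} {n : ℕ} (X : Fin n → Ω → E) : MeasurableSpace Ω :=
  MeasurableSpace.comap (fun ω i => X i ω) MeasurableSpace.pi

/-- Number of clustering errors on the selected set `S`, after label switching by `σ`. -/
def errCount {Q n : ℕ} (S : Finset (Fin n)) (σ : Equiv.Perm (Fin Q))
    (zh : Fin n → Fin Q) (z : Fin n → Fin Q) : ℝ :=
  ∑ i ∈ S, if z i ≠ σ (zh i) then 1 else 0

/-- The false clustering rate (FCR) of the procedure `(zh, S)`. -/
def fcr {Ω : Type*} [MeasurableSpace Ω] {Q n : ℕ} (μ : Measure Ω)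
    (Z : Fin n → Ω → Fin Q) (X : Fin n → Ω → E)
    (zh : (Fin n → E) → Fin n → Fin Q) (S : (Fin n → E) → Finset (Fin n)) : ℝ :=
  ∫ ω, ⨅ σ : Equiv.Perm (Fin Q),
      (μ[fun ω' => errCount (S fun j => X j ω') σ (zh fun j => X j ω') (fun i => Z i ω')
          / max ((S fun j => X j ω').card : ℝ) 1 | sigmaX X]) ω ∂μ

/-- The marginal false clustering rate (mFCR) of the procedure `(zh, S)`, with `0/0 = 0`. -/
def mfcr {Ω : Type*} [MeasurableSpace Ω] {Q n : ℕ} (μ : Measure Ω)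
    (Z : Fin n → Ω → Fin Q) (X : Fin n → Ω → E)
    (zh : (Fin n → E) → Fin n → Fin Q) (S : (Fin n → E) → Finset (Fin n)) : ℝ :=
  (∫ ω, ⨅ σ : Equiv.Perm (Fin Q),
      (μ[fun ω' => errCount (S fun j => X j ω') σ (zh fun j => X j ω') (fun i => Z i ω')
        | sigmaX X]) ω ∂μ)
    / ∫ ω, ((S fun j => X j ω).card : ℝ) ∂μ

/-- The clustering risk of the clustering rule `zh`. -/
def risk {Ω : Type*} [MeasurableSpace Ω] {Q n : ℕ} (μ : Measure Ω)
    (Z : Fin n → Ω → Fin Q) (X : Fin n → Ω → E)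
    (zh : (Fin n → E) → Fin n → Fin Q) : ℝ :=
  ∫ ω, ⨅ σ : Equiv.Perm (Fin Q),
      (μ[fun ω' => (n : ℝ)⁻¹ *
          ∑ i, (if Z i ω' ≠ σ (zh (fun j => X j ω') i) then (1 : ℝ) else 0) | sigmaX X]) ω ∂μ

/-! ### Population functionals (one observation with law `ν = margLaw θ*`) -/

/-- `L₁(θ,t) = P_{θ*}(T(X,θ) < t)`, with `X ∼ ν`. -/
def probT {Q : ℕ} (ν : Measure E) (f : U → E → ℝ) (piF : P → Fin Q → ℝ)
    (phiF : P → Fin Q → U) (θ : P) (t : ℝ) : ℝ :=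
  (ν {x | Tstat f piF phiF θ x < t}).toReal

/-- `L₀(θ,t) = E_{θ*}[T(X,θ) 1{T(X,θ)<t}]`. -/
def L0pop {Q : ℕ} (ν : Measure E) (f : U → E → ℝ) (piF : P → Fin Q → ℝ)
    (phiF : P → Fin Q → U) (θ : P) (t : ℝ) : ℝ :=
  ∫ x in {x | Tstat f piF phiF θ x < t}, Tstat f piF phiF θ x ∂ν

/-- `mfcr*_t = E_{θ*}(T(X,θ*) | T(X,θ*) < t)`, equal to `0` when the conditioning event is null. -/
def mfcrStar {Q : ℕ} (ν : Measure E) (f : U → E → ℝ) (piF : P → Fin Q → ℝ)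
    (phiF : P → Fin Q → U) (θs : P) (t : ℝ) : ℝ :=
  L0pop ν f piF phiF θs t / probT ν f piF phiF θs t

/-- `t*(α) = sup{t ∈ [0,1] : mfcr*_t ≤ α}`. -/
def tstarF {Q : ℕ} (ν : Measure E) (f : U → E → ℝ) (piF : P → Fin Q → ℝ)
    (phiF : P → Fin Q → U) (θs : P) (α : ℝ) : ℝ :=
  sSup {t | t ∈ Set.Icc (0:ℝ) 1 ∧ mfcrStar ν f piF phiF θs t ≤ α}

/-- `α_c = inf{mfcr*_t : t ∈ (0,1], mfcr*_t > 0}`. -/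
def alphac {Q : ℕ} (ν : Measure E) (f : U → E → ℝ) (piF : P → Fin Q → ℝ)
    (phiF : P → Fin Q → U) (θs : P) : ℝ :=
  sInf {a | 0 < a ∧ ∃ t ∈ Set.Ioc (0:ℝ) 1, mfcrStar ν f piF phiF θs t = a}

/-- `ᾱ = mfcr*_1`. -/
def alphabar {Q : ℕ} (ν : Measure E) (f : U → E → ℝ) (piF : P → Fin Q → ℝ)
    (phiF : P → Fin Q → U) (θs : P) : ℝ :=
  mfcrStar ν f piF phiF θs 1

/-- Assumption 1: for every `θ ∈ Θ`, `t ↦ P_{θ*}(T(X,θ) < t)` is continuous on `[0,1]` and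
increasing on `(α_c, ᾱ)`. -/
def Assum1 {Q : ℕ} (ν : Measure E) (f : U → E → ℝ) (piF : P → Fin Q → ℝ)
    (phiF : P → Fin Q → U) (Θset : Set P) (θs : P) : Prop :=
  ∀ θ ∈ Θset, ContinuousOn (fun t => probT ν f piF phiF θ t) (Set.Icc 0 1) ∧
    StrictMonoOn (fun t => probT ν f piF phiF θ t)
      (Set.Ioo (alphac ν f piF phiF θs) (alphabar ν f piF phiF θs))

section Moduli
variable [NormedAddCommGroup P]

/-- Modulus `W_ℓ(ε)`. -/
def Wl {Q : ℕ} (ν : Measure E) (f : U → E → ℝ) (piF : P → Fin Q → ℝ)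
    (phiF : P → Fin Q → U) (Θset : Set P) (θs : P) (ε : ℝ) : ℝ :=
  sSup {w | ∃ θ ∈ Θset, ‖θ - θs‖ ≤ ε ∧
    w = ∫ x, (⨆ q, |post f piF phiF θs q x - post f piF phiF θ q x|) ∂ν}

/-- Modulus `W_T(δ)`. -/
def WT {Q : ℕ} (ν : Measure E) (f : U → E → ℝ) (piF : P → Fin Q → ℝ)
    (phiF : P → Fin Q → U) (θs : P) (δ : ℝ) : ℝ :=
  sSup {w | ∃ t ∈ Set.Icc (0:ℝ) 1, ∃ t' ∈ Set.Icc (0:ℝ) 1, |t' - t| ≤ δ ∧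
    w = |probT ν f piF phiF θs t' - probT ν f piF phiF θs t|}

/-- Modulus `Ψ(ε) = inf_{δ ∈ (0,1)} (W_T(δ) + W_ℓ(ε)/δ)`. -/
def Psi {Q : ℕ} (ν : Measure E) (f : U → E → ℝ) (piF : P → Fin Q → ℝ)
    (phiF : P → Fin Q → U) (Θset : Set P) (θs : P) (ε : ℝ) : ℝ :=
  sInf {w | ∃ δ ∈ Set.Ioo (0:ℝ) 1,
    w = WT ν f piF phiF θs δ + Wl ν f piF phiF Θset θs ε / δ}

/-- Modulus `W_{t*,α}(v)`. -/
def Wtstar {Q : ℕ} (ν : Measure E) (f : U → E → ℝ) (piF : P → Fin Q → ℝ)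
    (phiF : P → Fin Q → U) (θs : P) (α v : ℝ) : ℝ :=
  sSup {w | ∃ β : ℝ, |β| ≤ v ∧
    w = |tstarF ν f piF phiF θs (α + β) - tstarF ν f piF phiF θs α|}

end Moduli

/-! ### Plug-in procedure -/

/-- The sum of the `k` smallest values of `t`. -/
def kSmallSum {n : ℕ} (t : Fin n → ℝ) (k : ℕ) : ℝ :=
  ⨅ A : {A : Finset (Fin n) // A.card = k}, ∑ i ∈ A.1, t i

open Classical in
/-- `K`: the largest `k ∈ {0,…,n}` with `max(k,1)⁻¹ Σ_{j=1}^k T̂_(j) ≤ α`. -/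
def Kcount {n : ℕ} (t : Fin n → ℝ) (α : ℝ) : ℕ :=
  Nat.findGreatest (fun k => kSmallSum t k / max (k : ℝ) 1 ≤ α) n

/-- Empirical `L̂(θ,t)` (with the convention `0/0 = 0`). -/
def Lhat {Q n : ℕ} (f : U → E → ℝ) (piF : P → Fin Q → ℝ) (phiF : P → Fin Q → U)
    (θ : P) (x : Fin n → E) (t : ℝ) : ℝ :=
  (∑ i, if Tstat f piF phiF θ (x i) < t then Tstat f piF phiF θ (x i) else 0) /
    (∑ i, if Tstat f piF phiF θ (x i) < t then (1:ℝ) else 0)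

/-- The data-driven threshold `t̂(α) = sup{t ∈ [0,1] : L̂(θ̂,t) ≤ α}`. -/
def that {Q n : ℕ} (f : U → E → ℝ) (piF : P → Fin Q → ℝ) (phiF : P → Fin Q → U)
    (θ : P) (x : Fin n → E) (α : ℝ) : ℝ :=
  sSup {t | t ∈ Set.Icc (0:ℝ) 1 ∧ Lhat f piF phiF θ x t ≤ α}

/-- Empirical `L̂₁(θ,t)`. -/
def L1hat {Q n : ℕ} (f : U → E → ℝ) (piF : P → Fin Q → ℝ) (phiF : P → Fin Q → U)
    (θ : P) (t : ℝ) (x : Fin n → E) : ℝ :=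
  (n : ℝ)⁻¹ * ∑ i, if Tstat f piF phiF θ (x i) < t then (1:ℝ) else 0

/-- Empirical `L̂₀(θ,t)`. -/
def L0hat {Q n : ℕ} (f : U → E → ℝ) (piF : P → Fin Q → ℝ) (phiF : P → Fin Q → U)
    (θ : P) (t : ℝ) (x : Fin n → E) : ℝ :=
  (n : ℝ)⁻¹ * ∑ i, if Tstat f piF phiF θ (x i) < t then Tstat f piF phiF θ (x i) else 0

/-- Empirical `M̂₀(θ,t)`, using the argmax selector `qbar` and the true parameter `θs`. -/
def M0hat {Q n : ℕ} (f : U → E → ℝ) (piF : P → Fin Q → ℝ) (phiF : P → Fin Q → U)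
    (θs : P) (qbar : P → E → Fin Q) (θ : P) (t : ℝ) (x : Fin n → E) : ℝ :=
  (n : ℝ)⁻¹ * ∑ i, if Tstat f piF phiF θ (x i) < t
      then 1 - post f piF phiF θs (qbar θ (x i)) (x i) else 0

/-- Population `M₀(θ,t)`. -/
def M0pop {Q : ℕ} (ν : Measure E) (f : U → E → ℝ) (piF : P → Fin Q → ℝ)
    (phiF : P → Fin Q → U) (θs : P) (qbar : P → E → Fin Q) (θ : P) (t : ℝ) : ℝ :=
  ∫ x in {x | Tstat f piF phiF θ x < t}, (1 - post f piF phiF θs (qbar θ x) x) ∂ν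

open Classical in
/-- Oracle selection `S*_t = {i : T*_i < t}`. -/
def Sstar {Q n : ℕ} (f : U → E → ℝ) (piF : P → Fin Q → ℝ) (phiF : P → Fin Q → U)
    (θs : P) (t : ℝ) (x : Fin n → E) : Finset (Fin n) :=
  Finset.univ.filter fun i => Tstat f piF phiF θs (x i) < t

section Eta
variable [NormedAddCommGroup P]

/-- `η(ε,θ*) = P_{θ*}(min_σ ‖θ̂^σ - θ*‖ ≥ ε)`. -/
def etaP {Ω : Type*} [MeasurableSpace Ω] {Q n : ℕ} (μ : Measure Ω) (X : Fin n → Ω → E)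
    (θhat : (Fin n → E) → P) (permAct : Equiv.Perm (Fin Q) → P → P) (θs : P) (ε : ℝ) : ℝ :=
  (μ {ω | ∀ σ : Equiv.Perm (Fin Q), ε ≤ ‖permAct σ (θhat fun i => X i ω) - θs‖}).toReal

end Eta

end FCRPaper

open FCRPaper

namespace FCRAux

variable {E : Type*} [MeasurableSpace E]

/-- Strict bound for the truncated mean. -/
lemma bound_lt (ν : Measure E) [IsFiniteMeasure ν] (T : E → ℝ) (h0 : ∀ x, 0 ≤ T x)
    (t : ℝ) (ht : 0 < t) :
    (∫ x in {x | T x < t}, T x ∂ν) / (ν {x | T x < t}).toReal < t := by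
  by_cases hm : AEStronglyMeasurable T (ν.restrict {x | T x < t})
  swap
  · rw [integral_undef (fun h => hm h.1)]
    simpa using ht
  by_cases hz : ν {x | T x < t} = 0
  · rw [hz]; simpa using ht
  have hpos : 0 < (ν {x | T x < t}).toReal := ENNReal.toReal_pos hz (measure_ne_top _ _)
  have hae : ∀ᵐ x ∂(ν.restrict {x | T x < t}), T x < t := by
    rw [ae_restrict_iff₀]
    · exact Filter.Eventually.of_forall fun x hx => hx
    · exact nullMeasurableSet_lt hm.aemeasurable aemeasurable_const
  have hint : Integrable T (ν.restrict {x | T x < t}) := by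
    refine Integrable.of_bound hm t ?_
    filter_upwards [hae] with x hx
    rw [Real.norm_eq_abs, abs_of_nonneg (h0 x)]
    exact hx.le
  rw [div_lt_iff₀ hpos]
  have hc : ∫ x in {x | T x < t}, (t - T x) ∂ν
      = t * (ν {x | T x < t}).toReal - ∫ x in {x | T x < t}, T x ∂ν := by
    rw [integral_sub (integrable_const _) hint]
    simp [Measure.real, mul_comm]
  have hp : 0 < ∫ x in {x | T x < t}, (t - T x) ∂ν := by
    rw [integral_pos_iff_support_of_nonneg_ae]
    · have : (ν.restrict {x | T x < t}) (Function.support fun x => t - T x)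
          = (ν.restrict {x | T x < t}) Set.univ := by
        apply measure_congr
        filter_upwards [hae] with x hx
        apply propext
        change (t - T x ≠ 0) ↔ True
        exact iff_true_intro (sub_pos.2 hx).ne'
      rw [this, Measure.restrict_apply_univ]
      exact pos_iff_ne_zero.2 hz
    · filter_upwards [hae] with x hx
      exact (sub_pos.2 hx).le
    · exact (integrable_const _).sub hint
  linarith

lemma L0_diff (ν : Measure E) [IsFiniteMeasure ν] (T : E → ℝ) (h0 : ∀ x, 0 ≤ T x)
    (h1 : ∀ x, T x ≤ 1)
    (hm : AEStronglyMeasurable T (ν.restrict {x | T x < 1})) (a b : ℝ) (hab : a ≤ b)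
    (hb : b ≤ 1) :
    |(∫ x in {x | T x < b}, T x ∂ν) - ∫ x in {x | T x < a}, T x ∂ν| ≤
      |(ν {x | T x < b}).toReal - (ν {x | T x < a}).toReal| := by
  set ρ := ν.restrict {x | T x < 1} with hρ
  have hn : ∀ c : ℝ, NullMeasurableSet {x | T x < c} ρ := fun c =>
    nullMeasurableSet_lt hm.aemeasurable aemeasurable_const
  have hr : ∀ c : ℝ, c ≤ 1 → ν.restrict {x | T x < c} = ρ.restrict {x | T x < c} := by
    intro c hc
    rw [hρ, Measure.restrict_restrict₀ (hn c)]
    congr 1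
    ext x
    exact ⟨fun h => ⟨h, lt_of_lt_of_le h hc⟩, fun h => h.1⟩
  have hv : ∀ c : ℝ, c ≤ 1 → ν {x | T x < c} = ρ {x | T x < c} := by
    intro c hc
    rw [← Measure.restrict_apply_univ {x | T x < c}, hr c hc, Measure.restrict_apply_univ]
  have hint : Integrable T ρ := by
    refine Integrable.of_bound hm 1 (Filter.Eventually.of_forall fun x => ?_)
    rw [Real.norm_eq_abs, abs_of_nonneg (h0 x)]
    exact h1 x
  have hsub : {x | T x < a} ⊆ {x | T x < b} := fun x hx => lt_of_lt_of_le hx hab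
  rw [hr a (hab.trans hb), hr b hb, hv a (hab.trans hb), hv b hb]
  have key : ∀ g : E → ℝ, Integrable g ρ →
      (∫ x in {x | T x < b}, g x ∂ρ) - ∫ x in {x | T x < a}, g x ∂ρ
        = ∫ x in {x | T x < b} \ {x | T x < a}, g x ∂ρ := by
    intro g hg
    have hu : {x | T x < a} ∪ ({x | T x < b} \ {x | T x < a}) = {x | T x < b} :=
      Set.union_diff_cancel hsub
    have := setIntegral_union₀ (μ := ρ) (f := g) (s := {x | T x < a})
      (t := {x | T x < b} \ {x | T x < a})
      (Set.disjoint_sdiff_right.aedisjoint) ((hn b).diff (hn a)) hg.integrableOn hg.integrableOn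
    rw [hu] at this
    linarith
  have k1 := key T hint
  have k2 := key (fun _ => 1) (integrable_const _)
  simp only [integral_const, smul_eq_mul, mul_one, Measure.real,
    Measure.restrict_apply_univ] at k2
  rw [k1, k2]
  rw [abs_of_nonneg (integral_nonneg h0), abs_of_nonneg ENNReal.toReal_nonneg]
  calc ∫ x in {x | T x < b} \ {x | T x < a}, T x ∂ρ
      ≤ ∫ x in {x | T x < b} \ {x | T x < a}, (1 : ℝ) ∂ρ :=
        integral_mono hint.integrableOn (integrable_const _) h1
    _ = _ := by simp [Measure.real]

lemma post_sum_bounds {U P : Type*} {Q : ℕ} [NeZero Q] (f : U → E → ℝ) (piF : P → Fin Q → ℝ)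
    (phiF : P → Fin Q → U) (θs : P) (hpi : ∀ q, 0 < piF θs q) (hfnn : ∀ u x, 0 ≤ f u x) (x : E) :
    0 ≤ Tstat f piF phiF θs x ∧ Tstat f piF phiF θs x ≤ 1 := by
  have hnn : ∀ q, 0 ≤ piF θs q * f (phiF θs q) x := fun q => mul_nonneg (hpi q).le (hfnn _ _)
  have hS : 0 ≤ ∑ l, piF θs l * f (phiF θs l) x := Finset.sum_nonneg fun q _ => hnn q
  have hp0 : ∀ q, 0 ≤ post f piF phiF θs q x := fun q => div_nonneg (hnn q) hS
  have hp1 : ∀ q, post f piF phiF θs q x ≤ 1 := fun q =>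
    div_le_one_of_le₀ (Finset.single_le_sum (f := fun l => piF θs l * f (phiF θs l) x)
      (fun i _ => hnn i) (Finset.mem_univ q)) hS
  have a1 : ⨆ q, post f piF phiF θs q x ≤ 1 := ciSup_le hp1
  have a2 : 0 ≤ ⨆ q, post f piF phiF θs q x := Real.iSup_nonneg hp0
  unfold Tstat
  constructor <;> linarith

end FCRAux

/-- **Properties of `t ↦ mfcr*_t`, parts 2 and 3 (Lemma 9 (ii)-(iii) of the paper).**
Under Assumption 1: `mfcr*_t < t` for every `t ∈ (0,1]`, and `t ↦ mfcr*_t` is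
continuous on `(t*(α_c), 1]`. -/
theorem mfcr_star_properties_part2_3
    {E U P : Type*} [MeasurableSpace E] (μE : Measure E)
    {Q : ℕ} [NeZero Q] (f : U → E → ℝ) (piF : P → Fin Q → ℝ) (phiF : P → Fin Q → U)
    (Θset : Set P) (θs : P) (hθs : θs ∈ Θset)
    -- mixture model assumptions
    (hpi : ∀ q, 0 < piF θs q) (hpisum : ∑ q, piF θs q = 1)
    (hfnn : ∀ u x, 0 ≤ f u x)
    (hfint : ∀ u, ∫⁻ x, ENNReal.ofReal (f u x) ∂μE = 1)
    (hphiinj : Function.Injective (phiF θs))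
    -- the marginal law of one observation under θ*
    (ν : Measure E) (hν : ν = margLaw μE f piF phiF θs)
    -- Assumption 1
    (hA1 : Assum1 ν f piF phiF Θset θs) :
    (∀ t ∈ Set.Ioc (0:ℝ) 1, mfcrStar ν f piF phiF θs t < t) ∧
    ContinuousOn (fun t => mfcrStar ν f piF phiF θs t)
      (Set.Ioc (tstarF ν f piF phiF θs (alphac ν f piF phiF θs)) 1) := by
  have hfin : IsFiniteMeasure ν := by
    constructor
    rw [hν, margLaw, Measure.finsetSum_apply]
    refine ENNReal.sum_lt_top.2 fun q _ => ?_
    rw [Measure.smul_apply, withDensity_apply _ MeasurableSet.univ, Measure.restrict_univ, hfint]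
    simp
  have hT := FCRAux.post_sum_bounds f piF phiF θs hpi hfnn
  refine ⟨fun t ht => FCRAux.bound_lt ν _ (fun x => (hT x).1) t ht.1, ?_⟩
  have hac : 0 ≤ alphac ν f piF phiF θs := Real.sInf_nonneg fun a ha => ha.1.le
  have hbdd : BddAbove {t | t ∈ Set.Icc (0:ℝ) 1 ∧
      mfcrStar ν f piF phiF θs t ≤ alphac ν f piF phiF θs} := ⟨1, fun t ht => ht.1.2⟩
  have hts0 : 0 ≤ tstarF ν f piF phiF θs (alphac ν f piF phiF θs) :=
    Real.sSup_nonneg fun t ht => ht.1.1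
  have hle : ∀ t ∈ Set.Icc (0:ℝ) 1, mfcrStar ν f piF phiF θs t = 0 →
      t ≤ tstarF ν f piF phiF θs (alphac ν f piF phiF θs) := fun t ht h =>
    le_csSup hbdd ⟨ht, h.trans_le hac⟩
  by_cases hm : AEStronglyMeasurable (Tstat f piF phiF θs)
      (ν.restrict {x | Tstat f piF phiF θs x < 1})
  swap
  · have h1 : mfcrStar ν f piF phiF θs 1 = 0 := by
      unfold mfcrStar L0pop
      rw [integral_undef (fun h => hm h.1), zero_div]
    have := hle 1 ⟨zero_le_one, le_rfl⟩ h1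
    rw [Set.Ioc_eq_empty (not_lt.2 this)]
    exact continuousOn_empty _
  have hsub : Set.Ioc (tstarF ν f piF phiF θs (alphac ν f piF phiF θs)) 1 ⊆ Set.Icc 0 1 :=
    fun t ht => ⟨hts0.trans ht.1.le, ht.2⟩
  have hc1 := (hA1 θs hθs).1.mono hsub
  have hd : ∀ a b : ℝ, a ≤ 1 → b ≤ 1 →
      dist (L0pop ν f piF phiF θs a) (L0pop ν f piF phiF θs b) ≤
      dist (probT ν f piF phiF θs a) (probT ν f piF phiF θs b) := by
    intro a b ha hb
    rcases le_total a b with h | h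
    · rw [dist_comm, dist_comm (probT ν f piF phiF θs a)]
      exact FCRAux.L0_diff ν _ (fun x => (hT x).1) (fun x => (hT x).2) hm a b h hb
    · exact FCRAux.L0_diff ν _ (fun x => (hT x).1) (fun x => (hT x).2) hm b a h ha
  have hc0 : ContinuousOn (fun t => L0pop ν f piF phiF θs t)
      (Set.Ioc (tstarF ν f piF phiF θs (alphac ν f piF phiF θs)) 1) := by
    rw [Metric.continuousOn_iff] at hc1 ⊢
    intro b hb ε hε
    obtain ⟨δ, hδ, h⟩ := hc1 b hb ε hε
    exact ⟨δ, hδ, fun a ha hab => (hd a b ha.2 hb.2).trans_lt (h a ha hab)⟩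
  refine hc0.div hc1 fun t ht h => ?_
  have : mfcrStar ν f piF phiF θs t = 0 := by
    unfold mfcrStar
    rw [h, div_zero]
  exact absurd (hle t (hsub ht) this) (not_le.2 ht.1)
end
end

section
/- (Wasserstein distance dominates parameter distance for discrete mixing measures.) Let G* = Σ_{q=1}^Q π*_q δ_{φ*_q} be a discrete probability measure on a normed parameter space 𝒰, with π*_q > 0 for all q and distinct atoms φ*_1,…,φ*_Q, and let G_n = Σ_{q=1}^Q π^n_q δ_{φ^n_q} be a sequence of discrete probability measures on 𝒰 with Q support points. If W₁(G_n, G*) → 0, then there exists a constant C > 0 depending only on G* such that for all sufficiently large n, W₁(G_n, G*) ≥ C · min_{σ∈[Q]} ( Σ_{q=1}^Q ‖φ^n_{σ(q)} − φ*_q‖ + Σ_{q=1}^Q |π^n_{σ(q)} − π*_q| ). -/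
open Finset

noncomputable section

/-- Order-1 Wasserstein distance between two discrete measures
`G₁ = Σ_q π¹_q δ_{φ¹_q}` and `G₂ = Σ_q π²_q δ_{φ²_q}` on a normed parameter space,
each with `Q` support points. -/
def wasserstein1 {Q : ℕ} {U : Type*} [NormedAddCommGroup U]
    (π1 : Fin Q → ℝ) (φ1 : Fin Q → U) (π2 : Fin Q → ℝ) (φ2 : Fin Q → U) : ℝ :=
  sInf {c | ∃ p : Fin Q → Fin Q → ℝ,
    (∀ q l, 0 ≤ p q l ∧ p q l ≤ 1) ∧
    (∀ q, ∑ l, p q l = π1 q) ∧ (∀ l, ∑ q, p q l = π2 l) ∧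
    c = ∑ q, ∑ l, p q l * ‖φ1 q - φ2 l‖}

lemma exists_pos_lower {α : Type*} [Finite α] (f : α → ℝ) (hf : ∀ a, 0 < f a) :
    ∃ d > 0, ∀ a, d ≤ f a := by
  cases isEmpty_or_nonempty α with
  | inl h => exact ⟨1, one_pos, fun a => h.elim a⟩
  | inr h =>
    obtain ⟨a, ha⟩ := Finite.exists_min f
    exact ⟨f a, hf a, ha⟩

lemma coupling_core {Q : ℕ} {U : Type*} [NormedAddCommGroup U]
    (πs : Fin Q → ℝ) (φs : Fin Q → U) (π1 : Fin Q → ℝ) (φ1 : Fin Q → U)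
    (m d : ℝ) (hm : 0 < m) (hd : 0 < d) (hms : ∀ q, m ≤ πs q)
    (hds : ∀ i j, i ≠ j → d ≤ ‖φs i - φs j‖)
    (p : Fin Q → Fin Q → ℝ) (hp : ∀ q l, 0 ≤ p q l)
    (h1 : ∀ q, ∑ l, p q l = π1 q) (h2 : ∀ l, ∑ q, p q l = πs l)
    (hc : ∑ q, ∑ l, p q l * ‖φ1 q - φs l‖ < m * d / 4) :
    ∃ σ : Equiv.Perm (Fin Q), ∑ q, ‖φ1 (σ q) - φs q‖ + ∑ q, |π1 (σ q) - πs q| ≤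
      (2 * Q * (1 / d + 1 / m)) * ∑ q, ∑ l, p q l * ‖φ1 q - φs l‖ := by
  set c := ∑ q, ∑ l, p q l * ‖φ1 q - φs l‖ with hcdef
  have hnn : ∀ q l, 0 ≤ p q l * ‖φ1 q - φs l‖ := fun q l => mul_nonneg (hp q l) (norm_nonneg _)
  have hrow : ∀ q, ∑ l, p q l * ‖φ1 q - φs l‖ ≤ c := fun q =>
    Finset.single_le_sum (f := fun q => ∑ l, p q l * ‖φ1 q - φs l‖)
      (fun i _ => Finset.sum_nonneg fun j _ => hnn i j) (Finset.mem_univ q)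
  have hcol : ∀ l, ∑ q, p q l * ‖φ1 q - φs l‖ ≤ c := fun l => by
    rw [hcdef, Finset.sum_comm]
    exact Finset.single_le_sum (f := fun l => ∑ q, p q l * ‖φ1 q - φs l‖)
      (fun i _ => Finset.sum_nonneg fun j _ => hnn j i) (Finset.mem_univ l)
  have hent : ∀ q l, p q l * ‖φ1 q - φs l‖ ≤ c := fun q l =>
    (Finset.single_le_sum (f := fun l => p q l * ‖φ1 q - φs l‖)
      (fun j _ => hnn q j) (Finset.mem_univ l)).trans (hrow q)
  have hex : ∀ l, ∃ q, ‖φ1 q - φs l‖ < d / 2 := by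
    intro l
    by_contra! hcon
    have h3 : πs l * (d / 2) ≤ c := by
      rw [← h2 l, Finset.sum_mul]
      exact (Finset.sum_le_sum fun q _ =>
        mul_le_mul_of_nonneg_left (hcon q) (hp q l)).trans (hcol l)
    nlinarith [hms l, mul_pos hm hd]
  choose s hs using hex
  have hfar : ∀ l j, l ≠ j → d / 2 ≤ ‖φ1 (s l) - φs j‖ := by
    intro l j hlj
    have h3 := hds l j hlj
    have h4 := norm_sub_le_norm_sub_add_norm_sub (φs l) (φ1 (s l)) (φs j)
    rw [norm_sub_rev (φs l) (φ1 (s l))] at h4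
    linarith [hs l]
  have hinj : Function.Injective s := by
    intro i j hij
    by_contra hne
    have := hfar i j hne
    rw [hij] at this
    linarith [hs j]
  let σ : Equiv.Perm (Fin Q) := Equiv.ofBijective s (Finite.injective_iff_bijective.mp hinj)
  have hσ : ∀ q, σ q = s q := fun q => rfl
  have hR : ∀ l, (π1 (s l) - p (s l) l) * (d / 2) ≤ c := by
    intro l
    rw [← h1, ← Finset.sum_erase_eq_sub (Finset.mem_univ l), Finset.sum_mul]
    refine le_trans ?_ (hrow (s l))
    refine le_trans (Finset.sum_le_sum fun j hj => mul_le_mul_of_nonneg_left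
      (hfar l j (Finset.ne_of_mem_erase hj).symm) (hp _ _)) ?_
    exact Finset.sum_le_sum_of_subset_of_nonneg (Finset.subset_univ _) fun j _ _ => hnn _ j
  have hL : ∀ l, (πs l - p (s l) l) * (d / 2) ≤ c := by
    intro l
    rw [← h2, ← Equiv.sum_comp σ (fun q => p q l)]
    simp only [hσ]
    rw [← Finset.sum_erase_eq_sub (f := fun j => p (s j) l) (Finset.mem_univ l), Finset.sum_mul]
    refine le_trans ?_ (hcol l)
    rw [← Equiv.sum_comp σ (fun q => p q l * ‖φ1 q - φs l‖)]
    simp only [hσ]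
    refine le_trans (Finset.sum_le_sum fun j hj => mul_le_mul_of_nonneg_left
      (hfar j l (Finset.ne_of_mem_erase hj)) (hp _ _)) ?_
    exact Finset.sum_le_sum_of_subset_of_nonneg (Finset.subset_univ _) fun j _ _ => hnn _ l
  have hRn : ∀ l, p (s l) l ≤ π1 (s l) := fun l => by
    rw [← h1]
    exact Finset.single_le_sum (f := fun j => p (s l) j) (fun j _ => hp _ j) (Finset.mem_univ l)
  have hLn : ∀ l, p (s l) l ≤ πs l := fun l => by
    rw [← h2]
    exact Finset.single_le_sum (f := fun j => p j l) (fun j _ => hp j _) (Finset.mem_univ (s l))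
  have hA : ∀ l, |π1 (σ l) - πs l| ≤ 2 / d * c := by
    intro l
    rw [hσ]
    have e1 : π1 (s l) - p (s l) l ≤ 2 / d * c := by
      rw [div_mul_eq_mul_div, le_div_iff₀ hd]; linarith [hR l]
    have e2 : πs l - p (s l) l ≤ 2 / d * c := by
      rw [div_mul_eq_mul_div, le_div_iff₀ hd]; linarith [hL l]
    rw [abs_le]
    constructor <;> linarith [hRn l, hLn l]
  have hB : ∀ l, ‖φ1 (σ l) - φs l‖ ≤ 2 / m * c := by
    intro l
    rw [hσ]
    have e : m / 2 ≤ p (s l) l := by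
      by_contra! hlt
      have : m / 2 * (d / 2) ≤ (πs l - p (s l) l) * (d / 2) :=
        mul_le_mul_of_nonneg_right (by linarith [hms l]) (by linarith)
      linarith [hL l]
    rw [div_mul_eq_mul_div, le_div_iff₀ hm]
    have := mul_le_mul_of_nonneg_right e (norm_nonneg (φ1 (s l) - φs l))
    linarith [hent (s l) l]
  refine ⟨σ, ?_⟩
  have hA' := Finset.sum_le_sum fun l (_ : l ∈ Finset.univ) => hA l
  have hB' := Finset.sum_le_sum fun l (_ : l ∈ Finset.univ) => hB l
  simp only [Finset.sum_const, Finset.card_univ, Fintype.card_fin, nsmul_eq_mul] at hA' hB'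
  refine (add_le_add hB' hA').trans (le_of_eq ?_)
  ring

/-- **Wasserstein distance dominates parameter distance for discrete mixing measures.**
If `G* = Σ_q π*_q δ_{φ*_q}` has positive weights and distinct atoms, and `G_n` is a
sequence of discrete probability measures with `Q` support points such that
`W₁(G_n, G*) → 0`, then there is a constant `C > 0` depending only on `G*` such that
for all sufficiently large `n`,
`W₁(G_n, G*) ≥ C · min_σ ( Σ_q ‖φⁿ_{σ(q)} − φ*_q‖ + Σ_q |πⁿ_{σ(q)} − π*_q| )`. -/
theorem wasserstein_dominates_parameter_distance
    {Q : ℕ} {U : Type*} [NormedAddCommGroup U]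
    (πs : Fin Q → ℝ) (φs : Fin Q → U)
    (hπs : ∀ q, 0 < πs q) (hπssum : ∑ q, πs q = 1)
    (hφs : Function.Injective φs)
    (πn : ℕ → Fin Q → ℝ) (φn : ℕ → Fin Q → U)
    (hπn : ∀ n q, 0 ≤ πn n q) (hπnsum : ∀ n, ∑ q, πn n q = 1)
    (hW : Filter.Tendsto (fun n => wasserstein1 (πn n) (φn n) πs φs)
      Filter.atTop (nhds 0)) :
    ∃ C > 0, ∃ N : ℕ, ∀ n ≥ N,
      wasserstein1 (πn n) (φn n) πs φs ≥
        C * ⨅ σ : Equiv.Perm (Fin Q),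
          (∑ q, ‖φn n (σ q) - φs q‖ + ∑ q, |πn n (σ q) - πs q|) := by
  obtain ⟨m, hm, hms⟩ := exists_pos_lower πs hπs
  obtain ⟨d, hd, hds⟩ := exists_pos_lower
    (fun x : Fin Q × Fin Q => if x.1 = x.2 then 1 else ‖φs x.1 - φs x.2‖) (by
      rintro ⟨i, j⟩
      dsimp only
      split_ifs with h
      · exact one_pos
      · exact norm_pos_iff.mpr (sub_ne_zero.mpr fun e => h (hφs e)))
  have hds' : ∀ i j, i ≠ j → d ≤ ‖φs i - φs j‖ := fun i j hij => by
    simpa [hij] using hds (i, j)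
  have hK : 0 < 2 * (Q : ℝ) * (1 / d + 1 / m) + 1 := by positivity
  refine ⟨1 / (2 * (Q : ℝ) * (1 / d + 1 / m) + 1), by positivity, ?_⟩
  have hε : 0 < m * d / 4 := by positivity
  obtain ⟨N, hN⟩ := Filter.eventually_atTop.mp (hW.eventually_lt_const hε)
  refine ⟨N, fun n hn => ?_⟩
  have hWn := hN n hn
  by_contra hcon
  rw [ge_iff_le, not_le] at hcon
  have hlt := lt_min hWn hcon
  have hs1 : ∀ q, πs q ≤ 1 := fun q => hπssum ▸
    Finset.single_le_sum (fun j _ => (hπs j).le) (Finset.mem_univ q)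
  have hn1 : ∀ q, πn n q ≤ 1 := fun q => hπnsum n ▸
    Finset.single_le_sum (fun j _ => hπn n j) (Finset.mem_univ q)
  obtain ⟨c, ⟨p, hp, h1, h2, rfl⟩, hclt⟩ := exists_lt_of_csInf_lt
    (by
      refine ⟨_, fun q l => πn n q * πs l, ?_, ?_, ?_, rfl⟩
      · exact fun q l => ⟨mul_nonneg (hπn n q) (hπs l).le,
          mul_le_one₀ (hn1 q) (hπs l).le (hs1 l)⟩
      · intro q
        rw [← Finset.mul_sum, hπssum, mul_one]
      · intro l
        rw [← Finset.sum_mul, hπnsum, one_mul]) hlt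
  obtain ⟨hc1, hc2⟩ := lt_min_iff.mp hclt
  obtain ⟨σ, hσ⟩ := coupling_core πs φs (πn n) (φn n) m d hm hd hms hds' p
    (fun q l => (hp q l).1) h1 h2 hc1
  have hc0 : 0 ≤ ∑ q, ∑ l, p q l * ‖φn n q - φs l‖ :=
    Finset.sum_nonneg fun q _ => Finset.sum_nonneg fun l _ =>
      mul_nonneg (hp q l).1 (norm_nonneg _)
  have hinf := ciInf_le (Set.finite_range (fun σ : Equiv.Perm (Fin Q) =>
    (∑ q, ‖φn n (σ q) - φs q‖ + ∑ q, |πn n (σ q) - πs q|))).bddBelow σ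
  rw [div_mul_eq_mul_div, one_mul, lt_div_iff₀ hK] at hc2
  linarith
end
end
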